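/- Let Φ be a unital positive linear map on B(H), let 0 < m < M, and let f : [m,M] → (0,∞) be a continuous function such that t ↦ f(t)² is strictly concave on [m,M] and t ↦ t·f(t) is strictly convex on [m,M]. If A ∈ B(H) is a positive operator with mI ≤ A ≤ MI, then Φ(A f(A)) ≤ K · |Φ(f(A)) Φ(A)|, where K = κ(f(M)/f(m), 2)^{1/2} · K₁(m, M, f²)^{−1/2} · K₂(m, M, t f(t)). -/

import Mathlib

open scoped NNReal

variable {H : Type*} [NormedAddCommGroup H] [InnerProductSpace ℂ H] [CompleteSpace H]

/-- The absolute value `|X| = (X*X)^(1/2)` of a bounded operator `X` on a Hilbert space. -/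
noncomputable def opAbs (X : H →L[ℂ] H) : H →L[ℂ] H := CFC.sqrt (star X * X)

/-- `Φ` is a unital positive linear map on `B(H)`: `Φ(I) = I` and `Φ(X) ≥ 0` whenever `X ≥ 0`
(with respect to the Löwner order). -/
def IsUnitalPositiveMap (Φ : (H →L[ℂ] H) →ₗ[ℂ] (H →L[ℂ] H)) : Prop :=
  Φ 1 = 1 ∧ ∀ X : H →L[ℂ] H, 0 ≤ X → 0 ≤ Φ X

/-- `f : (0,∞) → (0,∞)` is operator convex: for all positive invertible operators `A, B` on `H`
and all `c ∈ [0,1]`, `f(cA + (1-c)B) ≤ c f(A) + (1-c) f(B)` in the Löwner order, where `f(A)` is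
given by the continuous functional calculus. -/
def IsOperatorConvexOn (H : Type*) [NormedAddCommGroup H] [InnerProductSpace ℂ H]
    [CompleteSpace H] (f : ℝ → ℝ) : Prop :=
  ∀ (A B : H →L[ℂ] H), 0 ≤ A → IsUnit A → 0 ≤ B → IsUnit B →
    ∀ c : ℝ, c ∈ Set.Icc (0 : ℝ) 1 →
      cfc f (c • A + (1 - c) • B) ≤ c • cfc f A + (1 - c) • cfc f B

/-- `f : (0,∞) → (0,∞)` is operator concave if `-f` is operator convex. -/
def IsOperatorConcaveOn (H : Type*) [NormedAddCommGroup H] [InnerProductSpace ℂ H]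
    [CompleteSpace H] (f : ℝ → ℝ) : Prop :=
  IsOperatorConvexOn H (fun t => -(f t))

/-- The generalized Kantorovich constant
`κ(h,p) = ((h^p − 1)/((p−1)(h−1))) · (((p−1)/p) · (h^p − 1)/(h^p − h))^p`. -/
noncomputable def kappa (h p : ℝ) : ℝ :=
  (h ^ p - 1) / ((p - 1) * (h - 1)) * (((p - 1) / p) * ((h ^ p - 1) / (h ^ p - h))) ^ p

/-- `K₁(m,M,g) = min_{t ∈ [m,M]} ((M−t)g(m) + (t−m)g(M)) / ((M−m)g(t))`. -/
noncomputable def K1 (m M : ℝ) (g : ℝ → ℝ) : ℝ :=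
  sInf ((fun t => ((M - t) * g m + (t - m) * g M) / ((M - m) * g t)) '' Set.Icc m M)

/-- `K₂(m,M,g) = max_{t ∈ [m,M]} ((M−t)g(m) + (t−m)g(M)) / ((M−m)g(t))`. -/
noncomputable def K2 (m M : ℝ) (g : ℝ → ℝ) : ℝ :=
  sSup ((fun t => ((M - t) * g m + (t - m) * g M) / ((M - m) * g t)) '' Set.Icc m M)

/-- The affine function interpolating `g` at `m` and `M`. -/
noncomputable def chord (m M : ℝ) (g : ℝ → ℝ) (t : ℝ) : ℝ :=
  ((M - t) * g m + (t - m) * g M) / (M - m)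

lemma chord_eq_convex_comb (m M : ℝ) (g : ℝ → ℝ) (t : ℝ) :
    chord m M g t = ((M - t) / (M - m)) * g m + ((t - m) / (M - m)) * g M := by
  unfold chord; ring

lemma chord_eq_affine (m M : ℝ) (g : ℝ → ℝ) :
    ∃ α β : ℝ, ∀ t, chord m M g t = α * t + β :=
  ⟨(g M - g m) / (M - m), (M * g m - m * g M) / (M - m), fun t => by unfold chord; ring⟩

lemma convex_weights {m M t : ℝ} (hmM : m < M) (ht : t ∈ Set.Icc m M) :
    0 ≤ (M - t) / (M - m) ∧ 0 ≤ (t - m) / (M - m) ∧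
      (M - t) / (M - m) + (t - m) / (M - m) = 1 ∧
      (M - t) / (M - m) * m + (t - m) / (M - m) * M = t := by
  have h : 0 < M - m := sub_pos.2 hmM
  refine ⟨div_nonneg (sub_nonneg.2 ht.2) h.le, div_nonneg (sub_nonneg.2 ht.1) h.le, ?_, ?_⟩ <;>
    field_simp <;> ring

lemma ConvexOn.le_chord {m M : ℝ} (hmM : m < M) {g : ℝ → ℝ} (hg : ConvexOn ℝ (Set.Icc m M) g)
    {t : ℝ} (ht : t ∈ Set.Icc m M) : g t ≤ chord m M g t := by
  obtain ⟨h0, h1, h2, h3⟩ := convex_weights hmM ht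
  have := hg.2 (Set.left_mem_Icc.2 hmM.le) (Set.right_mem_Icc.2 hmM.le) h0 h1 h2
  simp only [smul_eq_mul, h3] at this
  rwa [chord_eq_convex_comb]

lemma ConcaveOn.chord_le {m M : ℝ} (hmM : m < M) {g : ℝ → ℝ} (hg : ConcaveOn ℝ (Set.Icc m M) g)
    {t : ℝ} (ht : t ∈ Set.Icc m M) : chord m M g t ≤ g t := by
  obtain ⟨h0, h1, h2, h3⟩ := convex_weights hmM ht
  have := hg.2 (Set.left_mem_Icc.2 hmM.le) (Set.right_mem_Icc.2 hmM.le) h0 h1 h2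
  simp only [smul_eq_mul, h3] at this
  rwa [chord_eq_convex_comb]

lemma chord_pos {m M : ℝ} (hmM : m < M) {g : ℝ → ℝ} (hgpos : ∀ t ∈ Set.Icc m M, 0 < g t)
    {t : ℝ} (ht : t ∈ Set.Icc m M) : 0 < chord m M g t := by
  have ha := hgpos m (Set.left_mem_Icc.2 hmM.le)
  have hb := hgpos M (Set.right_mem_Icc.2 hmM.le)
  refine div_pos ?_ (sub_pos.2 hmM)
  rcases ht.1.eq_or_lt with rfl | h
  · simpa using mul_pos (sub_pos.2 hmM) ha
  · exact add_pos_of_nonneg_of_pos (mul_nonneg (sub_nonneg.2 ht.2) ha.le)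
      (mul_pos (sub_pos.2 h) hb)

lemma chord_div_eq (m M : ℝ) (g : ℝ → ℝ) (t : ℝ) :
    ((M - t) * g m + (t - m) * g M) / ((M - m) * g t) = chord m M g t / g t := by
  rw [chord, div_div]

lemma isCompact_image_chord_div {m M : ℝ} {g : ℝ → ℝ}
    (hgc : ContinuousOn g (Set.Icc m M)) (hgpos : ∀ t ∈ Set.Icc m M, 0 < g t) :
    IsCompact ((fun t => chord m M g t / g t) '' Set.Icc m M) := by
  refine isCompact_Icc.image_of_continuousOn (ContinuousOn.div ?_ hgc fun t ht => (hgpos t ht).ne')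
  unfold chord
  fun_prop

lemma K1_pos {m M : ℝ} (hmM : m < M) {g : ℝ → ℝ}
    (hgc : ContinuousOn g (Set.Icc m M)) (hgpos : ∀ t ∈ Set.Icc m M, 0 < g t) :
    0 < K1 m M g := by
  simp only [K1, chord_div_eq]
  obtain ⟨t, ht, h⟩ := (isCompact_image_chord_div hgc hgpos).sInf_mem
    ((Set.nonempty_Icc.2 hmM.le).image _)
  rw [← h]
  exact div_pos (chord_pos hmM hgpos ht) (hgpos t ht)

lemma K1_mul_le_chord {m M : ℝ} {g : ℝ → ℝ}
    (hgc : ContinuousOn g (Set.Icc m M)) (hgpos : ∀ t ∈ Set.Icc m M, 0 < g t)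
    {t : ℝ} (ht : t ∈ Set.Icc m M) : K1 m M g * g t ≤ chord m M g t := by
  rw [← le_div_iff₀ (hgpos t ht)]
  simp only [K1, chord_div_eq]
  exact csInf_le (isCompact_image_chord_div hgc hgpos).bddBelow (Set.mem_image_of_mem _ ht)

lemma chord_le_K2_mul {m M : ℝ} {g : ℝ → ℝ}
    (hgc : ContinuousOn g (Set.Icc m M)) (hgpos : ∀ t ∈ Set.Icc m M, 0 < g t)
    {t : ℝ} (ht : t ∈ Set.Icc m M) : chord m M g t ≤ K2 m M g * g t := by
  rw [← div_le_iff₀ (hgpos t ht)]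
  simp only [K2, chord_div_eq]
  exact le_csSup (isCompact_image_chord_div hgc hgpos).bddAbove (Set.mem_image_of_mem _ ht)

lemma K2_pos {m M : ℝ} (hmM : m < M) {g : ℝ → ℝ}
    (hgc : ContinuousOn g (Set.Icc m M)) (hgpos : ∀ t ∈ Set.Icc m M, 0 < g t) :
    0 < K2 m M g := by
  have hmem := Set.left_mem_Icc.2 hmM.le
  exact pos_of_mul_pos_left ((chord_pos hmM hgpos hmem).trans_le (chord_le_K2_mul hgc hgpos hmem))
    (hgpos m hmem).le

lemma left_lt_right_of_sq_concave_of_mul_convex {m M : ℝ} (hm : 0 < m) (hmM : m < M) {f : ℝ → ℝ}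
    (hfpos : ∀ t ∈ Set.Icc m M, 0 < f t)
    (hf2 : StrictConcaveOn ℝ (Set.Icc m M) (fun t => f t ^ 2))
    (htf : StrictConvexOn ℝ (Set.Icc m M) (fun t => t * f t)) : f m < f M := by
  have hl := Set.left_mem_Icc.2 hmM.le
  have hr := Set.right_mem_Icc.2 hmM.le
  have h1 := hf2.2 hl hr hmM.ne one_half_pos one_half_pos (add_halves 1)
  have h2 := htf.2 hl hr hmM.ne one_half_pos one_half_pos (add_halves 1)
  simp only [smul_eq_mul] at h1 h2
  set t := 1 / 2 * m + 1 / 2 * M with htdef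
  have ht := hfpos t ⟨by linarith, by linarith⟩
  have h3 : (f m + f M) / 2 < f t :=
    lt_of_pow_lt_pow_left₀ 2 ht.le (by nlinarith [sq_nonneg (f m - f M)])
  have h4 : t * ((f m + f M) / 2) < t * f t := mul_lt_mul_of_pos_left h3 (by linarith)
  have h5 : 0 < (M - m) * (f M - f m) := by rw [htdef] at h4; nlinarith
  linarith [pos_of_mul_pos_right h5 (sub_pos.2 hmM).le]

lemma mem_Icc_of_sq_concave_of_mul_convex {m M : ℝ} (hm : 0 < m) (hmM : m < M) {f : ℝ → ℝ}
    (hfpos : ∀ t ∈ Set.Icc m M, 0 < f t)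
    (hf2 : StrictConcaveOn ℝ (Set.Icc m M) (fun t => f t ^ 2))
    (htf : StrictConvexOn ℝ (Set.Icc m M) (fun t => t * f t))
    {t : ℝ} (ht : t ∈ Set.Icc m M) : f t ∈ Set.Icc (f m) (f M) := by
  have hlt := left_lt_right_of_sq_concave_of_mul_convex hm hmM hfpos hf2 htf
  have ha := hfpos m (Set.left_mem_Icc.2 hmM.le)
  have h1 := hf2.concaveOn.chord_le hmM ht
  have h2 := htf.convexOn.le_chord hmM ht
  rw [chord_eq_convex_comb] at h1 h2
  obtain ⟨w0, w1, w2, w3⟩ := convex_weights hmM ht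
  generalize (M - t) / (M - m) = u at *
  generalize (t - m) / (M - m) = v at *
  constructor
  · refine le_of_sq_le_sq ?_ (hfpos t ht).le
    have : v * f m ^ 2 ≤ v * f M ^ 2 := by gcongr
    calc f m ^ 2 = u * f m ^ 2 + v * f m ^ 2 := by rw [← add_mul, w2, one_mul]
      _ ≤ f t ^ 2 := by linarith
  · refine le_of_mul_le_mul_left ?_ (hm.trans_le ht.1)
    have : u * (m * f m) ≤ u * (m * f M) := by gcongr
    calc t * f t ≤ u * (m * f M) + v * (M * f M) := by linarith
      _ = t * f M := by rw [← w3]; ring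

/-- The defining expression of `kappa h 2` dominates the classical Kantorovich constant
`(a + b)² / (4ab)` with `h = b / a`. -/
lemma kantorovich_le_kappa_two {a b : ℝ} (ha : 0 < a) (hab : a < b) :
    (a + b) ^ 2 / (4 * a * b) ≤ kappa (b / a) 2 := by
  have hb := ha.trans hab
  have hd : b - a ≠ 0 := (sub_pos.2 hab).ne'
  have h : kappa (b / a) 2 = (a + b) ^ 2 / (4 * a * b) * ((a + b) / b) := by
    have h1 : b / a - 1 ≠ 0 := by
      rw [div_sub_one ha.ne']; exact div_ne_zero hd ha.ne'
    simp only [kappa, Real.rpow_two]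
    have e1 : (b / a) ^ 2 - 1 = (b / a + 1) * (b / a - 1) := by ring
    have e2 : (b / a) ^ 2 - b / a = b / a * (b / a - 1) := by ring
    rw [e2, e1, mul_div_mul_right _ _ h1, mul_div_mul_right _ _ h1]
    field_simp
    ring
  rw [h]
  refine le_mul_of_one_le_right (by positivity) ?_
  rw [one_le_div hb]
  linarith

section Operator

variable {A : H →L[ℂ] H} {Φ : (H →L[ℂ] H) →ₗ[ℂ] (H →L[ℂ] H)}

lemma spectrum_subset_Icc_of_smul_one_le {m M : ℝ} (hA : IsSelfAdjoint A)
    (hAm : m • (1 : H →L[ℂ] H) ≤ A) (hAM : A ≤ M • (1 : H →L[ℂ] H)) :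
    spectrum ℝ A ⊆ Set.Icc m M := by
  rw [← Algebra.algebraMap_eq_smul_one] at hAm hAM
  exact fun t ht => ⟨(algebraMap_le_iff_le_spectrum hA).1 hAm t ht,
    (le_algebraMap_iff_spectrum_le hA).1 hAM t ht⟩

lemma cfc_affine (hA : IsSelfAdjoint A) (α β : ℝ) :
    cfc (fun t : ℝ => α * t + β) A = α • A + β • (1 : H →L[ℂ] H) := by
  rw [cfc_add_const β (fun t : ℝ => α * t) A, cfc_const_mul_id α A,
    Algebra.algebraMap_eq_smul_one]

namespace IsUnitalPositiveMap

lemma mono (hΦ : IsUnitalPositiveMap Φ) {X Y : H →L[ℂ] H} (h : X ≤ Y) : Φ X ≤ Φ Y := by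
  have := hΦ.2 (Y - X) (sub_nonneg.2 h)
  rwa [map_sub, sub_nonneg] at this

lemma map_real_smul_one (hΦ : IsUnitalPositiveMap Φ) (r : ℝ) :
    Φ (r • (1 : H →L[ℂ] H)) = r • (1 : H →L[ℂ] H) := by
  rw [LinearMap.map_smul_of_tower, hΦ.1]

lemma map_cfc_chord (hΦ : IsUnitalPositiveMap Φ) (hA : 0 ≤ A) (m M : ℝ) (g : ℝ → ℝ) :
    Φ (cfc (chord m M g) A) = cfc (chord m M g) (Φ A) := by
  obtain ⟨α, β, h⟩ := chord_eq_affine m M g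
  rw [funext h, cfc_affine (.of_nonneg hA), cfc_affine (.of_nonneg (hΦ.2 A hA)), map_add,
    LinearMap.map_smul_of_tower, hΦ.map_real_smul_one]

/-- Reverse Kadison inequality with the Kantorovich constant. -/
lemma map_mul_self_le (hΦ : IsUnitalPositiveMap Φ) {X : H →L[ℂ] H} {a b : ℝ} (ha : 0 < a)
    (hb : 0 < b) (hX : 0 ≤ X) (hspec : spectrum ℝ X ⊆ Set.Icc a b) :
    Φ (X * X) ≤ ((a + b) ^ 2 / (4 * a * b)) • (Φ X * Φ X) := by
  have hX' : IsSelfAdjoint X := .of_nonneg hX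
  have hY' : IsSelfAdjoint (Φ X) := .of_nonneg (hΦ.2 X hX)
  have h1 : X * X ≤ (a + b) • X + (-(a * b)) • (1 : H →L[ℂ] H) := by
    rw [← cfc_affine hX', ← sq, ← cfc_pow_id (R := ℝ) X 2]
    refine cfc_mono fun t ht => ?_
    nlinarith [mul_nonneg (sub_nonneg.2 (hspec ht).1) (sub_nonneg.2 (hspec ht).2)]
  have h2 : (a + b) • Φ X + (-(a * b)) • (1 : H →L[ℂ] H) ≤
      ((a + b) ^ 2 / (4 * a * b)) • (Φ X * Φ X) := by
    rw [← cfc_affine hY', ← sq, ← cfc_pow_id (R := ℝ) (Φ X) 2, ← cfc_smul ..]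
    refine cfc_mono fun t _ => ?_
    have : (a + b) ^ 2 / (4 * a * b) * t ^ 2 - ((a + b) * t + -(a * b)) =
        a * b * ((a + b) * t / (2 * a * b) - 1) ^ 2 := by field_simp; ring
    rw [smul_eq_mul, ← sub_nonneg, this]
    positivity
  refine le_trans ?_ h2
  simpa only [map_add, LinearMap.map_smul_of_tower, hΦ.1] using hΦ.mono h1

end IsUnitalPositiveMap

end Operator

/-- **Theorem 3.3 (reverse of the asymmetric Choi–Davis inequality).** If `0 < m < M`,
`f : [m,M] → (0,∞)` is continuous with `f²` strictly concave and `t f(t)` strictly convex, and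
`A` is a positive operator with `mI ≤ A ≤ MI`, then `Φ(A f(A)) ≤ K |Φ(f(A)) Φ(A)|` with
`K = κ(f(M)/f(m), 2)^(1/2) · K₁(m,M,f²)^(-1/2) · K₂(m,M,t f(t))`. -/
theorem reverse_abs_choi_davis
    (Φ : (H →L[ℂ] H) →ₗ[ℂ] (H →L[ℂ] H)) (hΦ : IsUnitalPositiveMap Φ)
    (m M : ℝ) (hm : 0 < m) (hmM : m < M)
    (f : ℝ → ℝ)
    (hfc : ContinuousOn f (Set.Icc m M))
    (hfpos : ∀ t ∈ Set.Icc m M, 0 < f t)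
    (hf2 : StrictConcaveOn ℝ (Set.Icc m M) (fun t => f t ^ 2))
    (htf : StrictConvexOn ℝ (Set.Icc m M) (fun t => t * f t))
    (A : H →L[ℂ] H) (hA : 0 ≤ A)
    (hAm : m • (1 : H →L[ℂ] H) ≤ A) (hAM : A ≤ M • (1 : H →L[ℂ] H)) :
    Φ (A * cfc f A) ≤
      (kappa (f M / f m) 2 ^ ((1 : ℝ) / 2) * K1 m M (fun t => f t ^ 2) ^ (-(1 : ℝ) / 2) *
          K2 m M (fun t => t * f t)) • opAbs (Φ (cfc f A) * Φ A) := by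
  have hA' : IsSelfAdjoint A := .of_nonneg hA
  have hsA := spectrum_subset_Icc_of_smul_one_le hA' hAm hAM
  have hC : 0 ≤ Φ A := hΦ.2 A hA
  have hC' : IsSelfAdjoint (Φ A) := .of_nonneg hC
  have hsC : spectrum ℝ (Φ A) ⊆ Set.Icc m M :=
    spectrum_subset_Icc_of_smul_one_le hC' (hΦ.map_real_smul_one m ▸ hΦ.mono hAm)
      (hΦ.map_real_smul_one M ▸ hΦ.mono hAM)
  have hfA : ContinuousOn f (spectrum ℝ A) := hfc.mono hsA
  have hfC : ContinuousOn f (spectrum ℝ (Φ A)) := hfc.mono hsC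
  have hchord (g : ℝ → ℝ) (s : Set ℝ) : ContinuousOn (chord m M g) s := by
    unfold chord; fun_prop
  have hsqc : ContinuousOn (fun t => f t ^ 2) (Set.Icc m M) := hfc.pow 2
  have hsqpos : ∀ t ∈ Set.Icc m M, 0 < f t ^ 2 := fun t ht => pow_pos (hfpos t ht) 2
  have hmulc : ContinuousOn (fun t => t * f t) (Set.Icc m M) := continuousOn_id.mul hfc
  have hmulpos : ∀ t ∈ Set.Icc m M, 0 < t * f t := fun t ht =>
    mul_pos (hm.trans_le ht.1) (hfpos t ht)
  have hlt := left_lt_right_of_sq_concave_of_mul_convex hm hmM hfpos hf2 htf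
  have ha := hfpos m (Set.left_mem_Icc.2 hmM.le)
  have hb := ha.trans hlt
  have hκle := kantorovich_le_kappa_two ha hlt
  have hκ : 0 < kappa (f M / f m) 2 := lt_of_lt_of_le (by positivity) hκle
  have hK1 := K1_pos hmM hsqc hsqpos
  have hK2 := K2_pos hmM hmulc hmulpos
  have hB : 0 ≤ Φ (cfc f A) := hΦ.2 _ (cfc_nonneg fun t ht => (hfpos t (hsA ht)).le)
  have hB' : IsSelfAdjoint (Φ (cfc f A)) := .of_nonneg hB
  set κ := kappa (f M / f m) 2
  set k₁ := K1 m M (fun t => f t ^ 2)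
  set k₂ := K2 m M (fun t => t * f t)
  set B := Φ (cfc f A)
  set C := Φ A
  set D := cfc f C with hDdef
  have hCD : cfc (fun t => t * f t) C = C * D := by
    rw [cfc_mul (fun t => t) f C, cfc_id' ℝ C]
  have hDC : cfc (fun t => t * f t) C = D * C := by
    rw [← cfc_id' ℝ C, hDdef, ← cfc_mul .., cfc_id' ℝ C]
    simp only [mul_comm]
  -- The upper bound through the chord of `t * f t`.
  have hupper : Φ (A * cfc f A) ≤ k₂ • cfc (fun t => t * f t) C := by
    have h1 : A * cfc f A ≤ cfc (chord m M fun t => t * f t) A := by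
      have : A * cfc f A = cfc (fun t => t * f t) A := by
        rw [cfc_mul (fun t => t) f A, cfc_id' ℝ A]
      rw [this]
      exact cfc_mono (fun t ht => htf.convexOn.le_chord hmM (hsA ht))
        (hmulc.mono hsA) (hchord _ _)
    refine (hΦ.mono h1).trans ?_
    rw [hΦ.map_cfc_chord hA, ← cfc_smul _ _ _ (hmulc.mono hsC)]
    exact cfc_mono (fun t ht => chord_le_K2_mul hmulc hmulpos (hsC ht)) (hchord _ _)
      ((hmulc.mono hsC).const_smul k₂)
  -- The lower bound for `B * B` through the chord of `f ^ 2`.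
  have hlower : k₁ • (D * D) ≤ κ • (B * B) := by
    have h1 : k₁ • (D * D) ≤ cfc (chord m M fun t => f t ^ 2) C := by
      rw [← sq, ← cfc_pow f 2 C, ← cfc_smul _ _ _ (hsqc.mono hsC)]
      exact cfc_mono (fun t ht => K1_mul_le_chord hsqc hsqpos (hsC ht))
        ((hsqc.mono hsC).const_smul k₁) (hchord _ _)
    have h2 : cfc (chord m M fun t => f t ^ 2) A ≤ cfc f A * cfc f A := by
      rw [← sq, ← cfc_pow f 2 A]
      exact cfc_mono (fun t ht => hf2.concaveOn.chord_le hmM (hsA ht)) (hchord _ _)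
        (hsqc.mono hsA)
    have hspec : spectrum ℝ (cfc f A) ⊆ Set.Icc (f m) (f M) := by
      rw [cfc_map_spectrum f A]
      rintro _ ⟨t, ht, rfl⟩
      exact mem_Icc_of_sq_concave_of_mul_convex hm hmM hfpos hf2 htf (hsA ht)
    have h3 := hΦ.map_mul_self_le ha hb (cfc_nonneg fun t ht => (hfpos t (hsA ht)).le) hspec
    have hBB : 0 ≤ B * B := by simpa [hB'.star_eq] using star_mul_self_nonneg B
    calc k₁ • (D * D) ≤ Φ (cfc (chord m M fun t => f t ^ 2) A) := by
          rwa [hΦ.map_cfc_chord hA]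
      _ ≤ Φ (cfc f A * cfc f A) := hΦ.mono h2
      _ ≤ _ := h3
      _ ≤ κ • (B * B) := smul_le_smul_of_nonneg_right hκle hBB
  set s := κ ^ ((1 : ℝ) / 2) * k₁ ^ (-(1 : ℝ) / 2) with hs
  have hspos : 0 < s := mul_pos (Real.rpow_pos_of_pos hκ _) (Real.rpow_pos_of_pos hK1 _)
  have hss : s * s = k₁⁻¹ * κ := by
    rw [hs, mul_mul_mul_comm, ← Real.rpow_add hκ, ← Real.rpow_add hK1]
    norm_num [Real.rpow_neg_one, mul_comm]
  have hDD : D * D ≤ (s * s) • (B * B) := by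
    have := smul_le_smul_of_nonneg_left hlower (inv_pos.2 hK1).le
    rwa [smul_smul, smul_smul, inv_mul_cancel₀ hK1.ne', one_smul, ← hss] at this
  have hconj : (C * D) * (D * C) ≤ (s • opAbs (B * C)) * (s • opAbs (B * C)) := by
    have h := star_left_conjugate_le_conjugate hDD C
    have habs : opAbs (B * C) * opAbs (B * C) = C * (B * B) * C := by
      rw [opAbs, CFC.sqrt_mul_sqrt_self _ (star_mul_self_nonneg _), star_mul, hB'.star_eq,
        hC'.star_eq]
      simp only [mul_assoc]
    rw [smul_mul_smul_comm, habs]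
    rw [hC'.star_eq] at h
    simpa only [mul_assoc, mul_smul_comm, smul_mul_assoc] using h
  have hroot : cfc (fun t => t * f t) C ≤ s • opAbs (B * C) := by
    have hpos : 0 ≤ cfc (fun t => t * f t) C :=
      cfc_nonneg fun t ht => (hmulpos t (hsC ht)).le
    have habspos : 0 ≤ s • opAbs (B * C) := smul_nonneg hspos.le (CFC.sqrt_nonneg _)
    rw [← CFC.sqrt_mul_self _ hpos, ← CFC.sqrt_mul_self _ habspos]
    refine CFC.sqrt_le_sqrt _ _ ?_
    rw [← hCD, ← hDC] at hconj
    exact hconj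
  refine hupper.trans ?_
  rw [mul_comm s k₂, mul_smul]
  exact smul_le_smul_of_nonneg_left hroot hK2.le
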